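/- Let V and W be real Banach spaces with W reflexive, and let a be a bounded bilinear form on V × W. Suppose that (i) there exists a constant c₁ > 0 such that c₁ ‖v‖_V ≤ sup_{w ∈ W, w ≠ 0} a(v, w)/‖w‖_W for all v ∈ V, and (ii) the only w ∈ W satisfying a(v, w) = 0 for all v ∈ V is w = 0. Then there also exists a constant c₂ > 0 such that c₂ ‖w‖_W ≤ sup_{v ∈ V, v ≠ 0} a(v, w)/‖v‖_V for all w ∈ W. -/

import Mathlib

/-- A closed subspace of a real normed space that is not annihilated by any nonzero functional
is the whole space. -/
theorem Submodule.eq_top_of_isClosed_of_annihilator {E : Type*} [NormedAddCommGroup E]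
    [NormedSpace ℝ E] (p : Submodule ℝ E) (hp : IsClosed (p : Set E))
    (h : ∀ φ : StrongDual ℝ E, (∀ x ∈ p, φ x = 0) → φ = 0) : p = ⊤ := by
  by_contra hne
  obtain ⟨x, -, hx⟩ := SetLike.exists_of_lt (lt_top_iff_ne_top.2 hne)
  obtain ⟨φ, u, hφ, hu⟩ := geometric_hahn_banach_closed_point p.convex hp hx
  have hu0 : 0 < u := by simpa using hφ 0 p.zero_mem
  have hzero : φ = 0 := by
    refine h φ fun y hy => ?_
    by_contra hy0
    have := hφ ((u / φ y) • y) (p.smul_mem _ hy)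
    rw [map_smul, smul_eq_mul, div_mul_cancel₀ _ hy0] at this
    exact lt_irrefl _ this
  simp only [hzero, zero_apply] at hu
  exact lt_asymm hu hu0

/-- A continuous linear map from a Banach space into the dual of a reflexive space is surjective
if it is bounded below and its range separates points. -/
theorem ContinuousLinearMap.surjective_dual_of_bounded_below {V W : Type*}
    [NormedAddCommGroup V] [NormedSpace ℝ V] [CompleteSpace V]
    [NormedAddCommGroup W] [NormedSpace ℝ W]
    (hrefl : Function.Surjective (NormedSpace.inclusionInDoubleDual ℝ W))
    (A : V →L[ℝ] StrongDual ℝ W) {c : ℝ} (hc : 0 < c) (hA : ∀ v, c * ‖v‖ ≤ ‖A v‖)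
    (hsep : ∀ w : W, (∀ v, A v w = 0) → w = 0) : Function.Surjective A := by
  have hanti : AntilipschitzWith ⟨c⁻¹, by positivity⟩ A :=
    AddMonoidHomClass.antilipschitz_of_bound A fun v => by
      change ‖v‖ ≤ c⁻¹ * ‖A v‖
      rw [inv_mul_eq_div, le_div_iff₀ hc, mul_comm]
      exact hA v
  have hclosed : IsClosed (LinearMap.range A.toLinearMap : Set (StrongDual ℝ W)) := by
    rw [LinearMap.coe_range]
    exact hanti.isClosed_range A.uniformContinuous
  refine LinearMap.range_eq_top.1
    ((LinearMap.range A.toLinearMap).eq_top_of_isClosed_of_annihilator hclosed fun φ hφ => ?_)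
  obtain ⟨w, rfl⟩ := hrefl φ
  rw [hsep w fun v => hφ (A v) ⟨v, rfl⟩, map_zero]

/-- Banach–Nečas–Babuška theorem, implication (2) ⟹ (3):
If the inf-sup condition holds and the only `w` annihilated by all `a v` is `w = 0`,
then the dual inf-sup condition holds. -/
theorem stmt_1
    {V W : Type*} [NormedAddCommGroup V] [NormedSpace ℝ V] [CompleteSpace V]
    [NormedAddCommGroup W] [NormedSpace ℝ W] [CompleteSpace W]
    (hrefl : Function.Surjective (NormedSpace.inclusionInDoubleDual ℝ W))
    (a : V →ₗ[ℝ] W →ₗ[ℝ] ℝ) (M : ℝ) (hM : 0 ≤ M)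
    (hbdd : ∀ (v : V) (w : W), |a v w| ≤ M * ‖v‖ * ‖w‖)
    (c₁ : ℝ) (hc₁ : 0 < c₁)
    (hinfsup : ∀ v : V,
        c₁ * ‖v‖ ≤ ⨆ w : {w : W // w ≠ 0}, a v (w : W) / ‖(w : W)‖)
    (hinj : ∀ w : W, (∀ v : V, a v w = 0) → w = 0) :
    ∃ c₂ > (0 : ℝ), ∀ w : W,
      c₂ * ‖w‖ ≤ ⨆ v : {v : V // v ≠ 0}, a (v : V) w / ‖(v : V)‖ := by
  let A : V →L[ℝ] StrongDual ℝ W := a.mkContinuous₂ M hbdd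
  have hA : ∀ v, c₁ * ‖v‖ ≤ ‖A v‖ := fun v =>
    (hinfsup v).trans <| Real.iSup_le
      (fun w => div_le_of_le_mul₀ (norm_nonneg _) (norm_nonneg _)
        ((le_abs_self _).trans ((A v).le_opNorm w))) (norm_nonneg _)
  have hsurj := A.surjective_dual_of_bounded_below hrefl hc₁ hA hinj
  refine ⟨c₁, hc₁, fun w => ?_⟩
  rcases eq_or_ne w 0 with rfl | hw
  · simp
  obtain ⟨g, hg, hgw⟩ := exists_dual_vector ℝ w (norm_ne_zero_iff.2 hw)
  obtain ⟨v, rfl⟩ := hsurj g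
  have hvw : a v w = ‖w‖ := hgw
  have hv : v ≠ 0 := by
    rintro rfl
    simp at hg
  have hbound : BddAbove (Set.range fun v : {v : V // v ≠ 0} => a (v : V) w / ‖(v : V)‖) := by
    refine ⟨M * ‖w‖, ?_⟩
    rintro _ ⟨v, rfl⟩
    refine div_le_of_le_mul₀ (norm_nonneg _) (by positivity) ?_
    exact (le_abs_self _).trans ((hbdd v w).trans_eq (mul_right_comm _ _ _))
  refine le_trans ?_ (le_ciSup hbound ⟨v, hv⟩)
  rw [hvw, le_div_iff₀ (norm_pos_iff.2 hv), mul_right_comm]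
  exact mul_le_of_le_one_left (norm_nonneg w) ((hA v).trans_eq hg)
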